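/- arXiv:2403.19410 — 4 statements merged into one kernel-verified Lean document; each statement's English description precedes it below -/
import Mathlib

section
/- Let Q ⊆ ℤ^n, Ψ : ℤ^n → (0,1/2], and 0 < s < s(Q,Ψ). Then the set 𝓜 is unbounded, and for every M ∈ 𝓜 one has |Q(M)| ≥ M / (2 (log₂ M)^{n+1}). -/
noncomputable section

/-- `Ψ_*(q) = Ψ(q)/|q|` (max norm on `ℤ^n`). -/
def PsiStar {n : ℕ} (Ψ : (Fin n → ℤ) → ℝ) (q : Fin n → ℤ) : ℝ := Ψ q / ‖q‖

/-- `s(Q,Ψ) = inf {s ≥ 0 : ∑_{q ∈ Q} Ψ_*(q)^s < ∞}`. -/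
def sExp {n : ℕ} (Q : Set (Fin n → ℤ)) (Ψ : (Fin n → ℤ) → ℝ) : ℝ :=
  sInf {s : ℝ | 0 ≤ s ∧ Summable fun q : Q => PsiStar Ψ q ^ s}

/-- `Q(M) = {q ∈ Q : M/2 < Ψ_*(q)^{-s} ≤ M}`. -/
def QM {n : ℕ} (Q : Set (Fin n → ℤ)) (Ψ : (Fin n → ℤ) → ℝ) (s M : ℝ) : Set (Fin n → ℤ) :=
  {q | q ∈ Q ∧ M / 2 < PsiStar Ψ q ^ (-s) ∧ PsiStar Ψ q ^ (-s) ≤ M}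

/-- `𝓜 = {2^k : k ∈ ℕ, ∑_{q ∈ Q(2^k)} Ψ_*(q)^s ≥ k^{-(n+1)}}`. -/
def Mcal {n : ℕ} (Q : Set (Fin n → ℤ)) (Ψ : (Fin n → ℤ) → ℝ) (s : ℝ) : Set ℝ :=
  {M | ∃ k : ℕ, M = 2 ^ k ∧
    (((k : ℝ) ^ (n + 1))⁻¹ : ℝ) ≤ ∑' q : QM Q Ψ s (2 ^ k), PsiStar Ψ q ^ s}

end

theorem PsiStar_zero {n : ℕ} (Ψ : (Fin n → ℤ) → ℝ) : PsiStar Ψ 0 = 0 := by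
  simp [PsiStar]

theorem PsiStar_pos {n : ℕ} {Ψ : (Fin n → ℤ) → ℝ} {q : Fin n → ℤ} (hΨ : 0 < Ψ q) (hq : q ≠ 0) :
    0 < PsiStar Ψ q :=
  div_pos hΨ (norm_pos_iff.2 hq)

theorem PsiStar_nonneg {n : ℕ} {Ψ : (Fin n → ℤ) → ℝ} {q : Fin n → ℤ} (hΨ : 0 ≤ Ψ q) :
    0 ≤ PsiStar Ψ q :=
  div_nonneg hΨ (norm_nonneg q)

theorem norm_le_PsiStar_inv {n : ℕ} {Ψ : (Fin n → ℤ) → ℝ} {q : Fin n → ℤ} (hΨ : 0 < Ψ q)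
    (hΨ' : Ψ q ≤ 1) : ‖q‖ ≤ (PsiStar Ψ q)⁻¹ := by
  rw [PsiStar, inv_div, le_div_iff₀ hΨ]
  exact mul_le_of_le_one_right (norm_nonneg q) hΨ'

theorem one_le_norm_of_ne_zero {n : ℕ} {q : Fin n → ℤ} (hq : q ≠ 0) : 1 ≤ ‖q‖ := by
  obtain ⟨i, hi⟩ := Function.ne_iff.1 hq
  refine le_trans ?_ (norm_le_pi_norm q i)
  rw [Int.norm_eq_abs]
  exact_mod_cast Int.one_le_abs hi

theorem one_le_PsiStar_rpow_neg {n : ℕ} {Ψ : (Fin n → ℤ) → ℝ} {q : Fin n → ℤ} (hΨ : 0 < Ψ q)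
    (hΨ' : Ψ q ≤ 1) (hq : q ≠ 0) {s : ℝ} (hs : 0 ≤ s) : 1 ≤ PsiStar Ψ q ^ (-s) := by
  rw [Real.rpow_neg_eq_inv_rpow]
  exact Real.one_le_rpow ((one_le_norm_of_ne_zero hq).trans (norm_le_PsiStar_inv hΨ hΨ')) hs

theorem finite_QM {n : ℕ} (Q : Set (Fin n → ℤ)) {Ψ : (Fin n → ℤ) → ℝ}
    (hΨ : ∀ q, Ψ q ∈ Set.Ioc (0 : ℝ) (1 / 2)) {s : ℝ} (hs : 0 < s) (M : ℝ) :
    (QM Q Ψ s M).Finite := by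
  refine ((isCompact_closedBall (0 : Fin n → ℤ) (M ^ s⁻¹)).finite_of_discrete).subset ?_
  rintro q ⟨-, -, hM⟩
  have h0 : 0 ≤ (PsiStar Ψ q)⁻¹ := inv_nonneg.2 (PsiStar_nonneg (hΨ q).1.le)
  rw [Real.rpow_neg_eq_inv_rpow] at hM
  rw [mem_closedBall_zero_iff]
  calc ‖q‖ ≤ (PsiStar Ψ q)⁻¹ :=
        norm_le_PsiStar_inv (hΨ q).1 ((hΨ q).2.trans (by norm_num))
    _ = ((PsiStar Ψ q)⁻¹ ^ s) ^ s⁻¹ := (Real.rpow_rpow_inv h0 hs.ne').symm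
    _ ≤ M ^ s⁻¹ := Real.rpow_le_rpow (Real.rpow_nonneg h0 s) hM (inv_nonneg.2 hs.le)

theorem tsum_QM_le {n : ℕ} (Q : Set (Fin n → ℤ)) {Ψ : (Fin n → ℤ) → ℝ}
    (hΨ : ∀ q, Ψ q ∈ Set.Ioc (0 : ℝ) (1 / 2)) {s : ℝ} (hs : 0 < s) {M : ℝ} (hM : 0 < M) :
    ∑' q : QM Q Ψ s M, PsiStar Ψ q ^ s ≤ (QM Q Ψ s M).ncard * (2 / M) := by
  have := (finite_QM Q hΨ hs M).fintype
  rw [tsum_fintype, ← Nat.card_coe_set_eq, Nat.card_eq_fintype_card, ← nsmul_eq_mul]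
  refine Finset.sum_le_card_nsmul _ _ _ fun q _ => ?_
  have h := q.2.2.1
  rw [Real.rpow_neg (PsiStar_nonneg (hΨ q).1.le)] at h
  have h' := (lt_inv_comm₀ (half_pos hM) (inv_pos.1 ((half_pos hM).trans h))).1 h
  rw [inv_div] at h'
  exact h'.le

theorem exists_half_two_pow_lt_le {x : ℝ} (hx : 1 ≤ x) :
    ∃ k : ℕ, (2 : ℝ) ^ k / 2 < x ∧ x ≤ 2 ^ k := by
  classical
  have h : ∃ k : ℕ, x ≤ 2 ^ k :=
    (pow_unbounded_of_one_lt x one_lt_two).imp fun _ hk => hk.le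
  refine ⟨Nat.find h, ?_, Nat.find_spec h⟩
  rcases hk : Nat.find h with _ | k
  · norm_num
    linarith
  · have := Nat.find_min h (m := k) (by omega)
    rw [pow_succ, mul_div_cancel_right₀ _ two_ne_zero]
    exact not_le.1 this

theorem summable_of_summable_tsum_QM {n : ℕ} {Q : Set (Fin n → ℤ)} {Ψ : (Fin n → ℤ) → ℝ}
    (hΨ : ∀ q, Ψ q ∈ Set.Ioc (0 : ℝ) (1 / 2)) {s : ℝ} (hs : 0 < s)
    (h : Summable fun k : ℕ => ∑' q : QM Q Ψ s (2 ^ k), PsiStar Ψ q ^ s) :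
    Summable fun q : Q => PsiStar Ψ q ^ s := by
  have hnn : ∀ q, 0 ≤ PsiStar Ψ q ^ s := fun q =>
    Real.rpow_nonneg (PsiStar_nonneg (hΨ q).1.le) s
  let g : (Fin n → ℤ) → ENNReal := fun q => ENNReal.ofReal (PsiStar Ψ q ^ s)
  have hcover : Q ⊆ {0} ∪ ⋃ k : ℕ, QM Q Ψ s (2 ^ k) := by
    intro q hq
    by_cases h0 : q = 0
    · exact Or.inl h0
    · obtain ⟨k, hk⟩ := exists_half_two_pow_lt_le (one_le_PsiStar_rpow_neg (hΨ q).1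
        ((hΨ q).2.trans (by norm_num)) h0 hs.le)
      exact Or.inr (Set.mem_iUnion.2 ⟨k, hq, hk⟩)
  have hpiece : ∀ k : ℕ, ∑' q : QM Q Ψ s (2 ^ k), g q =
      ENNReal.ofReal (∑' q : QM Q Ψ s (2 ^ k), PsiStar Ψ q ^ s) := fun k => by
    have := (finite_QM Q hΨ hs (2 ^ k)).to_subtype
    exact (ENNReal.ofReal_tsum_of_nonneg (fun q : QM Q Ψ s (2 ^ k) => hnn q)
      Summable.of_finite).symm
  have hlt : ∑' q : Q, g q ≠ ⊤ := by
    refine ne_top_of_le_ne_top ?_ ((ENNReal.tsum_mono_subtype g hcover).trans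
      ((ENNReal.tsum_union_le g _ _).trans
        (add_le_add_right (ENNReal.tsum_iUnion_le_tsum g _) _)))
    simp only [hpiece, tsum_singleton]
    exact ENNReal.add_ne_top.2 ⟨ENNReal.ofReal_ne_top, h.tsum_ofReal_ne_top⟩
  exact (ENNReal.summable_toReal hlt).congr fun q => (ENNReal.toReal_ofReal (hnn q))

theorem not_summable_of_lt_sExp {n : ℕ} {Q : Set (Fin n → ℤ)} {Ψ : (Fin n → ℤ) → ℝ} {s : ℝ}
    (hs : 0 ≤ s) (hss : s < sExp Q Ψ) : ¬ Summable fun q : Q => PsiStar Ψ q ^ s := fun h =>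
  hss.not_ge (csInf_le ⟨0, fun _ ht => ht.1⟩ ⟨hs, h⟩)

/-- For `0 < s < s(Q,Ψ)`: the set `𝓜` is unbounded, and `|Q(M)| ≥ M/(2 (log₂ M)^{n+1})`
for every `M ∈ 𝓜`. -/
theorem Mcal_unbounded_and_QM_card (n : ℕ) (Q : Set (Fin n → ℤ)) (Ψ : (Fin n → ℤ) → ℝ)
    (hΨ : ∀ q, Ψ q ∈ Set.Ioc (0 : ℝ) (1 / 2)) (s : ℝ) (hs : 0 < s) (hss : s < sExp Q Ψ) :
    (∀ B : ℝ, ∃ M ∈ Mcal Q Ψ s, B < M) ∧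
    (∀ M ∈ Mcal Q Ψ s, M / (2 * Real.logb 2 M ^ (n + 1)) ≤ ((QM Q Ψ s M).ncard : ℝ)) := by
  constructor
  · intro B
    by_contra! hB
    have hns := not_summable_of_lt_sExp hs.le hss
    have hn : n ≠ 0 := by
      rintro rfl
      exact hns Summable.of_finite
    refine hns (summable_of_summable_tsum_QM hΨ hs ?_)
    refine Summable.of_norm_bounded_eventually_nat
      (Real.summable_nat_pow_inv.2 (show 1 < n + 1 by omega)) ?_
    filter_upwards [(tendsto_pow_atTop_atTop_of_one_lt
      (one_lt_two : (1 : ℝ) < 2)).eventually_gt_atTop B] with k hk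
    rw [Real.norm_of_nonneg (tsum_nonneg fun q : QM Q Ψ s (2 ^ k) =>
      Real.rpow_nonneg (PsiStar_nonneg (hΨ q).1.le) s)]
    by_contra! hlt
    exact hk.not_ge (hB _ ⟨k, rfl, hlt.le⟩)
  · rintro _ ⟨k, rfl, hk⟩
    have hM : (0 : ℝ) < 2 ^ k := by positivity
    have hlog : Real.logb 2 ((2 : ℝ) ^ k) = k := by
      rw [← Real.rpow_natCast, Real.logb_rpow two_pos (by norm_num)]
    have h := hk.trans (tsum_QM_le Q hΨ hs hM)
    rw [hlog]
    calc (2 : ℝ) ^ k / (2 * (k : ℝ) ^ (n + 1))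
        = ((k : ℝ) ^ (n + 1))⁻¹ * (2 ^ k / 2) := by
          rw [div_mul_eq_div_div, div_eq_mul_inv _ ((k : ℝ) ^ (n + 1)), mul_comm]
      _ ≤ (QM Q Ψ s (2 ^ k)).ncard * (2 / 2 ^ k) * (2 ^ k / 2) :=
          mul_le_mul_of_nonneg_right h (by positivity)
      _ = (QM Q Ψ s (2 ^ k)).ncard := by field_simp
end

section
/- For every nonzero ℓ ∈ ℤ^{mn}, if i₀ ∈ {1,…,m} and j₀ ∈ {1,…,n} are chosen so that |ℓ| = |ℓ_{i₀ j₀}| (max norm), then the map q = (q_1,…,q_n) ↦ q_{j₀} is an injection from D(ℓ) into the set of integers dividing ℓ_{i₀ j₀}; in particular, for q ∈ D(ℓ), q_j = q_{j₀} ℓ_{i₀ j}/ℓ_{i₀ j₀} for every j. -/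
/-- The set of divisors `D(ℓ) = {q ∈ ℤ^n : ∃ k ∈ ℤ^m, ℓ_{ij} = k_i q_j for all i,j}` of
`ℓ ∈ ℤ^{mn}` (identified with an `m × n` integer matrix). -/
def Dset (m n : ℕ) (l : Fin m × Fin n → ℤ) : Set (Fin n → ℤ) :=
  {q | ∃ k : Fin m → ℤ, ∀ i j, l (i, j) = k i * q j}

/-- `w_s(t) = exp(s log t / log log t)`. -/
noncomputable def wfun (s t : ℝ) : ℝ := Real.exp (s * Real.log t / Real.log (Real.log t))

/-- For nonzero `ℓ ∈ ℤ^{mn}` with max norm attained at `(i₀,j₀)`, the map `q ↦ q_{j₀}` is an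
injection of `D(ℓ)` into the divisors of `ℓ_{i₀j₀}`; moreover `q_j ℓ_{i₀j₀} = q_{j₀} ℓ_{i₀j}`
for all `j` (i.e. `q_j = q_{j₀} ℓ_{i₀j}/ℓ_{i₀j₀}`). -/
theorem Dset_inj (m n : ℕ) (l : Fin m × Fin n → ℤ) (hl : l ≠ 0)
    (i₀ : Fin m) (j₀ : Fin n) (hmax : ∀ p, |l p| ≤ |l (i₀, j₀)|) :
    Set.InjOn (fun q : Fin n → ℤ => q j₀) (Dset m n l) ∧
    (∀ q ∈ Dset m n l, q j₀ ∣ l (i₀, j₀)) ∧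
    (∀ q ∈ Dset m n l, ∀ j, q j * l (i₀, j₀) = q j₀ * l (i₀, j)) := by
  have hne : l (i₀, j₀) ≠ 0 := fun h => hl <| funext fun p => by
    simpa [h] using hmax p
  have hprop : ∀ q ∈ Dset m n l, ∀ j, q j * l (i₀, j₀) = q j₀ * l (i₀, j) := by
    rintro q ⟨k, hk⟩ j
    rw [hk, hk]
    ring
  refine ⟨fun q hq r hr h => funext fun j => mul_right_cancel₀ hne ?_, ?_, hprop⟩
  · rw [hprop q hq, hprop r hr]
    exact congrArg (· * l (i₀, j)) h
  · rintro q ⟨k, hk⟩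
    exact ⟨k i₀, by rw [hk, mul_comm]⟩
end

section
/- For every ζ > log 2 there exists a constant C_ζ such that for every ℓ ∈ ℤ^{mn} with |ℓ| ≥ 3, the number of divisors of ℓ satisfies |D(ℓ)| ≤ C_ζ · w_ζ(|ℓ|). -/
/-- One prime-power factor `a + 1` of the divisor function, compared with `p ^ (a δ)`. -/
lemma add_one_le_rpow_mul_ite {δ : ℝ} (hδ : 0 < δ) {p : ℕ} (hp : 2 ≤ p) (a : ℕ) :
    (a : ℝ) + 1 ≤ ((p : ℝ) ^ a) ^ δ *
      (if (p : ℝ) ≤ 2 ^ (1 / δ) then Real.exp (1 / (δ * Real.log 2)) else 1) := by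
  have hp2 : (2 : ℝ) ≤ p := by exact_mod_cast hp
  have hl2 : 0 < Real.log 2 := Real.log_pos one_lt_two
  have hpow : ((p : ℝ) ^ a) ^ δ = ((p : ℝ) ^ δ) ^ a := by
    rw [← Real.rpow_natCast, ← Real.rpow_natCast, ← Real.rpow_mul (by positivity),
      ← Real.rpow_mul (by positivity), mul_comm]
  rw [hpow]
  split_ifs with h
  · have h2 : Real.exp (a * (δ * Real.log 2)) ≤ ((p : ℝ) ^ δ) ^ a := by
      rw [Real.exp_nat_mul, mul_comm δ, ← Real.rpow_def_of_pos two_pos]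
      gcongr
    have hx : 0 < δ * Real.log 2 := by positivity
    have h3 := Real.add_one_le_exp (a * (δ * Real.log 2))
    have h4 := Real.add_one_le_exp (1 / (δ * Real.log 2))
    have ha : (0 : ℝ) ≤ a * (δ * Real.log 2) := by positivity
    calc (a : ℝ) + 1 ≤ (a * (δ * Real.log 2) + 1) * (1 / (δ * Real.log 2) + 1) := by
          have e : (a * (δ * Real.log 2) + 1) * (1 / (δ * Real.log 2) + 1)
              = a + 1 + (a * (δ * Real.log 2) + 1 / (δ * Real.log 2)) := by
            field_simp
            ring
          have : 0 < 1 / (δ * Real.log 2) := by positivity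
          linarith
      _ ≤ _ := by
          gcongr
          exact h3.trans h2
  · push Not at h
    have h2 : (2 : ℝ) ≤ (p : ℝ) ^ δ := by
      calc (2 : ℝ) = ((2 : ℝ) ^ (1 / δ)) ^ δ := by
            rw [← Real.rpow_mul two_pos.le, one_div_mul_cancel hδ.ne', Real.rpow_one]
        _ ≤ _ := by gcongr
    rw [mul_one]
    calc (a : ℝ) + 1 ≤ 2 ^ a := by exact_mod_cast Nat.lt_two_pow_self
      _ ≤ _ := by gcongr

/-- The divisor function bound `d(N) ≤ N ^ δ * exp (2 ^ (1 / δ) / (δ log 2))`. -/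
lemma card_divisors_le_rpow_mul_exp {δ : ℝ} (hδ : 0 < δ) {N : ℕ} (hN : N ≠ 0) :
    (N.divisors.card : ℝ) ≤
      (N : ℝ) ^ δ * Real.exp (2 ^ (1 / δ) * (1 / (δ * Real.log 2))) := by
  have hl2 : 0 < Real.log 2 := Real.log_pos one_lt_two
  have hfac : (N : ℝ) ^ δ = ∏ p ∈ N.primeFactors, ((p : ℝ) ^ N.factorization p) ^ δ := by
    rw [Real.finsetProd_rpow _ _ (fun _ _ => by positivity)]
    congr 1
    conv_lhs => rw [← Nat.prod_factorization_pow_eq_self hN]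
    simp [Finsupp.prod]
  have hcard : ((N.primeFactors.filter fun p : ℕ => (p : ℝ) ≤ 2 ^ (1 / δ)).card : ℝ)
      ≤ 2 ^ (1 / δ) := by
    have hsub : N.primeFactors.filter (fun p : ℕ => (p : ℝ) ≤ 2 ^ (1 / δ))
        ⊆ Finset.Icc 1 ⌊(2 : ℝ) ^ (1 / δ)⌋₊ := by
      intro p hp
      rw [Finset.mem_filter] at hp
      exact Finset.mem_Icc.2 ⟨(Nat.prime_of_mem_primeFactors hp.1).one_le, Nat.le_floor hp.2⟩
    have h := Finset.card_le_card hsub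
    rw [Nat.card_Icc, Nat.add_sub_cancel] at h
    exact (Nat.cast_le.2 h).trans (Nat.floor_le (by positivity))
  rw [Nat.card_divisors hN, hfac]
  push_cast
  calc ∏ p ∈ N.primeFactors, ((N.factorization p : ℝ) + 1)
      ≤ ∏ p ∈ N.primeFactors, (((p : ℝ) ^ N.factorization p) ^ δ *
          (if (p : ℝ) ≤ 2 ^ (1 / δ) then Real.exp (1 / (δ * Real.log 2)) else 1)) :=
        Finset.prod_le_prod (fun _ _ => by positivity) fun p hp =>
          add_one_le_rpow_mul_ite hδ (Nat.prime_of_mem_primeFactors hp).two_le _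
    _ ≤ _ := by
        rw [Finset.prod_mul_distrib, ← Finset.prod_filter, Finset.prod_const, ← Real.exp_nat_mul]
        gcongr

lemma one_le_wfun {s t : ℝ} (hs : 0 ≤ s) (ht : 3 ≤ t) : 1 ≤ wfun s t := by
  have h1 : 1 ≤ Real.log t := by
    rw [Real.le_log_iff_exp_le (by linarith)]
    linarith [Real.exp_one_lt_three]
  have := Real.log_nonneg h1
  unfold wfun
  exact Real.one_le_exp (by positivity)

open Filter Topology in
/-- Exponentials `exp (c x)` with `c < 1` are negligible against `exp x / x ^ 2`. -/
lemma eventually_exp_mul_mul_le {c η K : ℝ} (hc : c < 1) (hη : 0 < η) :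
    ∀ᶠ x : ℝ in atTop, Real.exp (c * x) * (x * K) ≤ η * Real.exp x / x := by
  have h : Tendsto (fun x : ℝ => x ^ (2 : ℝ) * Real.exp (-(1 - c) * x) * K) atTop (𝓝 (0 * K)) :=
    (tendsto_rpow_mul_exp_neg_mul_atTop_nhds_zero 2 (1 - c) (by linarith)).mul_const K
  rw [zero_mul] at h
  filter_upwards [h.eventually_le_const hη, eventually_gt_atTop 0] with x hx hx0
  rw [Real.rpow_two] at hx
  rw [le_div_iff₀ hx0]
  calc Real.exp (c * x) * (x * K) * x
      = x ^ 2 * Real.exp (-(1 - c) * x) * K * Real.exp x := by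
        rw [show c * x = -(1 - c) * x + x by ring, Real.exp_add]
        ring
    _ ≤ η * Real.exp x := by gcongr

/-- Wigert's bound `d(N) ≤ C w_ζ(N)` for `ζ > log 2`. -/
lemma exists_card_divisors_le_wfun {ζ : ℝ} (hζ : Real.log 2 < ζ) :
    ∃ C : ℝ, ∀ N : ℕ, 3 ≤ N → (N.divisors.card : ℝ) ≤ C * wfun ζ N := by
  have hl2 : 0 < Real.log 2 := Real.log_pos one_lt_two
  obtain ⟨s, hs, hsζ⟩ := exists_between hζ
  have hs0 : 0 < s := hl2.trans hs
  have hev := eventually_exp_mul_mul_le (c := Real.log 2 / s) (η := ζ - s)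
    (K := 1 / (s * Real.log 2)) ((div_lt_one hs0).2 hs) (by linarith)
  have hN : Filter.Tendsto (fun N : ℕ => Real.log (Real.log N)) Filter.atTop Filter.atTop :=
    Real.tendsto_log_atTop.comp (Real.tendsto_log_atTop.comp tendsto_natCast_atTop_atTop)
  obtain ⟨M, hM⟩ := Filter.eventually_atTop.1
    ((hN.eventually hev).and (hN.eventually_gt_atTop 0))
  refine ⟨M + 1, fun N hN3 => ?_⟩
  have hN3' : (3 : ℝ) ≤ N := by exact_mod_cast hN3
  have hw := one_le_wfun (hl2.trans hζ).le hN3'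
  rcases lt_or_ge N M with hlt | hge
  · have h1 : (N.divisors.card : ℝ) ≤ M := by
      exact_mod_cast (Nat.card_divisors_le_self N).trans hlt.le
    nlinarith [(Nat.cast_nonneg M : (0 : ℝ) ≤ M)]
  · obtain ⟨hb, hL⟩ := hM N hge
    have hlog : 0 < Real.log N := Real.log_pos (by linarith)
    set L := Real.log (Real.log N) with hLdef
    have hexpL : Real.exp L = Real.log N := Real.exp_log hlog
    have hmain := card_divisors_le_rpow_mul_exp (δ := s / L) (by positivity)
      (N := N) (by omega)
    have hle : (N.divisors.card : ℝ) ≤ wfun ζ N := by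
      refine hmain.trans ?_
      rw [Real.rpow_def_of_pos (by linarith : (0 : ℝ) < N), ← Real.exp_add, wfun, ← hLdef,
        Real.rpow_def_of_pos two_pos]
      apply Real.exp_le_exp.2
      rw [hexpL] at hb
      have e1 : Real.log 2 * (1 / (s / L)) = Real.log 2 / s * L := by field_simp
      have e2 : 1 / (s / L * Real.log 2) = L * (1 / (s * Real.log 2)) := by field_simp
      rw [e1, e2]
      calc _ ≤ Real.log N * (s / L) + (ζ - s) * Real.log N / L := by gcongr
        _ = _ := by ring
    nlinarith [(Nat.cast_nonneg M : (0 : ℝ) ≤ M)]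

/-- A nonzero integer has at most `2 d(|a|)` integer divisors. -/
lemma finite_and_ncard_int_dvd_le {a : ℤ} (ha : a ≠ 0) :
    {z : ℤ | z ∣ a}.Finite ∧ {z : ℤ | z ∣ a}.ncard ≤ 2 * a.natAbs.divisors.card := by
  classical
  set T : Finset ℤ := a.natAbs.divisors.image (fun d : ℕ => (d : ℤ)) ∪
    a.natAbs.divisors.image (fun d : ℕ => -(d : ℤ)) with hT
  have hsub : {z : ℤ | z ∣ a} ⊆ (T : Set ℤ) := by
    intro z hz
    have hd : z.natAbs ∈ a.natAbs.divisors :=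
      Nat.mem_divisors.2 ⟨Int.natAbs_dvd_natAbs.2 hz, Int.natAbs_ne_zero.2 ha⟩
    rw [Finset.mem_coe, hT, Finset.mem_union, Finset.mem_image, Finset.mem_image]
    rcases Int.natAbs_eq z with h | h
    · exact Or.inl ⟨_, hd, h.symm⟩
    · exact Or.inr ⟨_, hd, h.symm⟩
  refine ⟨T.finite_toSet.subset hsub, (Set.ncard_le_ncard hsub T.finite_toSet).trans ?_⟩
  rw [Set.ncard_coe_finset, two_mul]
  exact (Finset.card_union_le _ _).trans (add_le_add Finset.card_image_le Finset.card_image_le)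

/-- A divisor of `l` is determined by its coordinate in the column of any nonzero entry. -/
lemma ncard_Dset_le {m n : ℕ} {l : Fin m × Fin n → ℤ} {i : Fin m} {j : Fin n}
    (h : l (i, j) ≠ 0) : (Dset m n l).ncard ≤ 2 * (l (i, j)).natAbs.divisors.card := by
  obtain ⟨hfin, hcard⟩ := finite_and_ncard_int_dvd_le h
  refine (Set.ncard_le_ncard_of_injOn (fun q => q j) ?_ ?_ hfin).trans hcard
  · rintro q ⟨k, hk⟩
    exact ⟨k i, by rw [hk i j, mul_comm]⟩
  · rintro q ⟨k, hk⟩ q' ⟨k', hk'⟩ hqq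
    replace hqq : q j = q' j := hqq
    have hne : k i * q j ≠ 0 := hk i j ▸ h
    have hki : k i = k' i :=
      mul_right_cancel₀ (right_ne_zero_of_mul hne) (by rw [← hk i j, hk' i j, hqq])
    funext j'
    exact mul_left_cancel₀ (left_ne_zero_of_mul hne) (by rw [← hk i j', hk' i j', hki])

/-- Divisor bound: for every `ζ > log 2` there is a constant `C_ζ` such that
`|D(ℓ)| ≤ C_ζ w_ζ(|ℓ|)` for every `ℓ ∈ ℤ^{mn}` with `|ℓ| ≥ 3` (max norm). -/
theorem Dset_card_le (m n : ℕ) (ζ : ℝ) (hζ : Real.log 2 < ζ) :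
    ∃ C : ℝ, ∀ l : Fin m × Fin n → ℤ, 3 ≤ ‖l‖ →
      ((Dset m n l).ncard : ℝ) ≤ C * wfun ζ ‖l‖ := by
  obtain ⟨C, hC⟩ := exists_card_divisors_le_wfun hζ
  refine ⟨2 * C, fun l hl => ?_⟩
  obtain ⟨⟨i, j⟩, hij⟩ : ∃ x, ‖l‖ ≤ ‖l x‖ := by
    have : Nonempty (Fin m × Fin n) := by
      by_contra hne
      rw [not_nonempty_iff] at hne
      rw [Subsingleton.elim l 0, norm_zero] at hl
      linarith
    obtain ⟨x, hx⟩ := Finite.exists_max fun x => ‖l x‖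
    exact ⟨x, (pi_norm_le_iff_of_nonneg (norm_nonneg _)).2 hx⟩
  have hnorm : ‖l‖ = ((l (i, j)).natAbs : ℝ) := by
    rw [le_antisymm hij (norm_le_pi_norm l _), Int.norm_eq_abs, Nat.cast_natAbs, Int.cast_abs]
  rw [hnorm] at hl ⊢
  have h3 : 3 ≤ (l (i, j)).natAbs := by exact_mod_cast hl
  have hcard : ((Dset m n l).ncard : ℝ) ≤ 2 * ((l (i, j)).natAbs.divisors.card : ℝ) := by
    exact_mod_cast ncard_Dset_le (i := i) (j := j) (by omega)
  linarith [hC _ h3]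
end

section
/- Let ε > 0, θ ∈ ℝ^m, ℓ ∈ ℤ^{mn}, and q ∈ ℤ^n. For every j ∈ {1,…,n} with q_j ≠ 0, the ℓ-th Fourier coefficient of the ℤ^{mn}-periodic function Φ^ε_{q,θ}, namely ∫_{[0,1]^{mn}} Φ^ε_{q,θ}(x) e^{−2πi ℓ·x} dx, equals e^{−2πi q_j^{−1} ℓ_j · θ} φ̂(ε q_j^{−1} ℓ_j) if q ∈ D(ℓ), and equals 0 if q ∉ D(ℓ); here ℓ_j = (ℓ_{1j},…,ℓ_{mj}). -/
open MeasureTheory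

noncomputable section

/-- The Fourier transform on `ℝ^m`: `φ̂(ξ) = ∫ e^{-2πi x·ξ} φ(x) dx`. -/
def ftRm {m : ℕ} (φ : (Fin m → ℝ) → ℝ) (ξ : Fin m → ℝ) : ℂ :=
  ∫ x : Fin m → ℝ,
    Complex.exp (((-(2 * Real.pi * ∑ i, x i * ξ i) : ℝ) : ℂ) * Complex.I) * (φ x : ℂ)

/-- The `ℤ^m`-periodization `Φ^ε(y) = ∑_{r ∈ ℤ^m} ε^{-m} φ(ε^{-1}(y - r))`. -/
def PhiEps {m : ℕ} (φ : (Fin m → ℝ) → ℝ) (ε : ℝ) (y : Fin m → ℝ) : ℝ :=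
  ∑' r : Fin m → ℤ, (ε ^ m)⁻¹ * φ (fun i => (y i - (r i : ℝ)) / ε)

/-- `Φ^ε_{q,θ}(x) = Φ^ε(xq - θ)` for `x ∈ ℝ^{mn}` identified with an `m × n` matrix. -/
def PhiQ {m n : ℕ} (φ : (Fin m → ℝ) → ℝ) (ε : ℝ) (q : Fin n → ℤ) (θ : Fin m → ℝ)
    (x : Fin m × Fin n → ℝ) : ℝ :=
  PhiEps φ ε (fun i => (∑ j : Fin n, x (i, j) * (q j : ℝ)) - θ i)

/-- The `ℓ`-th Fourier coefficient `∫_{[0,1]^{mn}} f(x) e^{-2πi ℓ·x} dx` of a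
`ℤ^{mn}`-periodic function. -/
def fcoef {m n : ℕ} (f : (Fin m × Fin n → ℝ) → ℝ) (l : Fin m × Fin n → ℤ) : ℂ :=
  ∫ x in {x : Fin m × Fin n → ℝ | ∀ p, x p ∈ Set.Icc (0 : ℝ) 1},
    (f x : ℂ) * Complex.exp (((-(2 * Real.pi * ∑ p, x p * (l p : ℝ)) : ℝ) : ℂ) * Complex.I)

end


section Torus

variable {ι κ : Type*} [Fintype ι] [Fintype κ]

theorem setOf_forall_mem_Icc_eq {ι : Type*} :
    {x : ι → ℝ | ∀ i, x i ∈ Set.Icc (0 : ℝ) 1} = Set.Icc (fun _ => 0) (fun _ => 1) := by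
  ext x
  simp [Set.mem_Icc, Pi.le_def, forall_and]

/-- The projection `ℝ^ι → (ℝ/ℤ)^ι` maps Lebesgue measure on the closed unit cube to the Haar
probability measure. -/
theorem measurePreserving_unitCube_torus :
    MeasurePreserving (fun (x : ι → ℝ) (i : ι) => (x i : UnitAddCircle))
      (volume.restrict {x : ι → ℝ | ∀ i, x i ∈ Set.Icc (0 : ℝ) 1})
      (volume : Measure (UnitAddTorus ι)) := by
  have h := measurePreserving_pi _ _ (fun _ : ι => UnitAddCircle.measurePreserving_mk 0)
  rw [← Measure.restrict_pi_pi] at h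
  rw [setOf_forall_mem_Icc_eq, volume_pi, ← Measure.restrict_congr_set
    (Measure.univ_pi_Ioc_ae_eq_Icc (μ := fun _ : ι => (volume : Measure ℝ)))]
  simp only [zero_add] at h
  exact h

/-- A measurable `ℤ^ι`-periodic function descends to a measurable function on the torus. -/
theorem exists_measurable_torus_lift {ι : Type*} {w : (ι → ℝ) → ℂ} (hw : Measurable w)
    (hper : ∀ (x : ι → ℝ) (r : ι → ℤ), w (fun i => x i + r i) = w x) :
    ∃ W : UnitAddTorus ι → ℂ, Measurable W ∧
      ∀ x : ι → ℝ, W (fun i => (x i : UnitAddCircle)) = w x := by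
  refine ⟨fun y => w (fun i => (AddCircle.measurableEquivIoc 1 0 (y i) : ℝ)), ?_, fun x => ?_⟩
  · refine hw.comp (measurable_pi_lambda _ fun i => ?_)
    exact measurable_subtype_coe.comp
      ((AddCircle.measurableEquivIoc 1 0).measurable.comp (measurable_pi_apply i))
  · have h : ∀ i, ∃ r : ℤ,
        (AddCircle.measurableEquivIoc 1 0 (x i : UnitAddCircle) : ℝ) = x i + r := by
      intro i
      have h1 : (((AddCircle.measurableEquivIoc 1 0 (x i : UnitAddCircle) : ℝ)) : UnitAddCircle)
          = x i := (AddCircle.measurableEquivIoc 1 0).symm_apply_apply (x i : UnitAddCircle)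
      rw [← sub_eq_zero, ← AddCircle.coe_sub, AddCircle.coe_eq_zero_iff] at h1
      obtain ⟨r, hr⟩ := h1
      exact ⟨r, by rw [zsmul_eq_mul, mul_one] at hr; linarith⟩
    choose r hr using h
    simp only [hr, hper]

/-- Integrals of periodic functions over the unit cube are invariant under maps covering a
measure-preserving map of tori. -/
theorem setIntegral_unitCube_comp {w : (κ → ℝ) → ℂ} (hw : Measurable w)
    (hper : ∀ (x : κ → ℝ) (r : κ → ℤ), w (fun i => x i + r i) = w x)
    {A : UnitAddTorus ι → UnitAddTorus κ} (hA : MeasurePreserving A volume volume)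
    {a : (ι → ℝ) → κ → ℝ}
    (ha : ∀ x, A (fun i => (x i : UnitAddCircle)) = fun k => (a x k : UnitAddCircle)) :
    ∫ x in {x : ι → ℝ | ∀ i, x i ∈ Set.Icc (0 : ℝ) 1}, w (a x) =
      ∫ x in {x : κ → ℝ | ∀ i, x i ∈ Set.Icc (0 : ℝ) 1}, w x := by
  obtain ⟨W, hW, hWw⟩ := exists_measurable_torus_lift hw hper
  have hι := hA.comp (measurePreserving_unitCube_torus (ι := ι))
  have hκ := measurePreserving_unitCube_torus (ι := κ)
  calc _ = ∫ x in {x : ι → ℝ | ∀ i, x i ∈ Set.Icc (0 : ℝ) 1},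
          W ((A ∘ fun (x : ι → ℝ) (i : ι) => (x i : UnitAddCircle)) x) := by
        simp only [Function.comp_apply, ha, hWw]
    _ = ∫ y, W y := by
        rw [← hι.map_eq, integral_map hι.measurable.aemeasurable hW.aestronglyMeasurable]
    _ = _ := by
        rw [← hκ.map_eq, integral_map hκ.measurable.aemeasurable hW.aestronglyMeasurable]
        simp only [hWw]

theorem setIntegral_unitCube_add {w : (ι → ℝ) → ℂ} (hw : Measurable w)
    (hper : ∀ (x : ι → ℝ) (r : ι → ℤ), w (fun i => x i + r i) = w x) (t : ι → ℝ) :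
    ∫ x in {x : ι → ℝ | ∀ i, x i ∈ Set.Icc (0 : ℝ) 1}, w (fun i => x i + t i) =
      ∫ x in {x : ι → ℝ | ∀ i, x i ∈ Set.Icc (0 : ℝ) 1}, w x :=
  setIntegral_unitCube_comp hw hper
    (measurePreserving_add_right volume (fun i => (t i : UnitAddCircle)))
    (a := fun x i => x i + t i) (fun x => by ext i; simp)

/-- The homomorphism `x ↦ xq` of tori, with `x` an `ι × κ` matrix. -/
noncomputable def torusMulVec (ι : Type*) {κ : Type*} [Fintype κ] (q : κ → ℤ) :
    UnitAddTorus (ι × κ) →+ UnitAddTorus ι where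
  toFun x i := ∑ j, q j • x (i, j)
  map_zero' := by ext i; simp
  map_add' x y := by ext i; simp [Finset.sum_add_distrib]

theorem measurePreserving_torusMulVec {q : κ → ℤ} {j : κ} (hq : q j ≠ 0) :
    MeasurePreserving (torusMulVec ι q) volume volume := by
  classical
  refine AddMonoidHom.measurePreserving ?_ ?_ ?_
  · exact continuous_pi fun i => continuous_finsetSum _ fun k _ =>
      (continuous_apply (i, k)).zsmul (q k)
  · intro y
    have h : ∀ i, ∃ z : UnitAddCircle, q j • z = y i := fun i =>
      DivisibleBy.surjective_smul UnitAddCircle ℤ hq (y i)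
    choose z hz using h
    refine ⟨fun p => if p.2 = j then z p.1 else 0, ?_⟩
    ext i
    simp [torusMulVec, hz]
  · simp [volume_pi, Measure.pi_univ]

theorem setIntegral_unitCube_mulVec {w : (ι → ℝ) → ℂ} (hw : Measurable w)
    (hper : ∀ (x : ι → ℝ) (r : ι → ℤ), w (fun i => x i + r i) = w x)
    {q : κ → ℤ} {j : κ} (hq : q j ≠ 0) :
    ∫ x in {x : ι × κ → ℝ | ∀ p, x p ∈ Set.Icc (0 : ℝ) 1},
        w (fun i => ∑ j, x (i, j) * (q j : ℝ)) =
      ∫ x in {x : ι → ℝ | ∀ i, x i ∈ Set.Icc (0 : ℝ) 1}, w x := by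
  refine setIntegral_unitCube_comp hw hper (measurePreserving_torusMulVec hq)
    (a := fun x i => ∑ j, x (i, j) * (q j : ℝ)) fun x => ?_
  ext i
  change ∑ j, q j • (x (i, j) : UnitAddCircle) = _
  simp only [mul_comm _ ((q _ : ℤ) : ℝ), ← zsmul_eq_mul, ← AddCircle.coe_zsmul]
  exact (map_sum (QuotientAddGroup.mk' (AddSubgroup.zmultiples (1 : ℝ))) _ _).symm

/-- Unfolding: the integral of a periodization over the unit cube is the integral over `ℝ^ι`. -/
theorem setIntegral_unitCube_tsum {g : (ι → ℝ) → ℂ} (hg : Integrable g) :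
    ∫ x in {x : ι → ℝ | ∀ i, x i ∈ Set.Icc (0 : ℝ) 1},
        ∑' r : ι → ℤ, g (fun i => x i - r i) = ∫ x, g x := by
  set S : Set (ι → ℝ) := Set.univ.pi fun _ => Set.Ico 0 1
  rw [setOf_forall_mem_Icc_eq, volume_pi, ← setIntegral_congr_set
    (Measure.univ_pi_Ico_ae_eq_Icc (μ := fun _ : ι => (volume : Measure ℝ)))]
  rw [← volume_pi]
  change ∫ x in S, _ = _
  have hS : MeasurableSet S := MeasurableSet.univ_pi fun _ => measurableSet_Ico
  set T : (ι → ℤ) → Set (ι → ℝ) := fun r => (fun x i => x i + r i) ⁻¹' S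
  have hTm : ∀ r, MeasurableSet (T r) := fun r =>
    hS.preimage (measurable_add_const (fun i => (r i : ℝ)))
  have hfloor : ∀ r x, x ∈ T r ↔ ∀ i, -r i = ⌊x i⌋ := by
    intro r x
    simp only [T, S, Set.mem_preimage, Set.mem_univ_pi, Set.mem_Ico, eq_comm (a := -r _),
      Int.floor_eq_iff, Int.cast_neg]
    exact forall_congr' fun i => ⟨fun h => ⟨by linarith, by linarith⟩,
      fun h => ⟨by linarith, by linarith⟩⟩
  have hTd : Pairwise (Function.onFun Disjoint T) := by
    intro r s hrs
    refine Set.disjoint_left.2 fun x hr hs => hrs (funext fun i => ?_)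
    have h1 := (hfloor r x).1 hr i
    have h2 := (hfloor s x).1 hs i
    omega
  have hTu : ⋃ r, T r = Set.univ := by
    refine Set.eq_univ_of_forall fun x => Set.mem_iUnion.2 ⟨fun i => -⌊x i⌋, ?_⟩
    simp [hfloor]
  have hmp : ∀ r : ι → ℤ, MeasurePreserving (fun (x : ι → ℝ) i => x i + r i) volume volume :=
    fun r => measurePreserving_add_right volume (fun i => (r i : ℝ))
  have hemb : ∀ r : ι → ℤ, MeasurableEmbedding (fun (x : ι → ℝ) i => x i + (r i : ℝ)) :=
    fun r => measurableEmbedding_addRight (fun i => (r i : ℝ))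
  have hshift : ∀ {E : Type} [NormedAddCommGroup E] [NormedSpace ℝ E] (f : (ι → ℝ) → E)
      (r : ι → ℤ), ∫ x in T r, f x = ∫ x in S, f (fun i => x i - r i) := by
    intro E _ _ f r
    rw [← (hmp r).setIntegral_preimage_emb (hemb r) (fun x => f (fun i => x i - r i)) S]
    simp [T]
  have hsum := hasSum_integral_iUnion hTm hTd hg.integrableOn
  have hsumn := (hasSum_integral_iUnion hTm hTd hg.norm.integrableOn).summable
  rw [hTu, Measure.restrict_univ] at hsum
  simp only [hshift] at hsum hsumn
  rw [← hsum.tsum_eq]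
  refine (integral_tsum_of_summable_integral_norm (fun r => ?_) hsumn).symm
  exact (hg.comp_sub_right (fun i => (r i : ℝ))).integrableOn

end Torus

section Characters

variable {ι : Type*} [Fintype ι]

/-- The function `x ↦ e^{-2πi x·ξ}` on `ℝ^ι`. -/
noncomputable def expNeg (ξ x : ι → ℝ) : ℂ :=
  Complex.exp (((-(2 * Real.pi * ∑ i, x i * ξ i) : ℝ) : ℂ) * Complex.I)

theorem expNeg_add (ξ x y : ι → ℝ) :
    expNeg ξ (fun i => x i + y i) = expNeg ξ x * expNeg ξ y := by
  rw [expNeg, expNeg, expNeg, ← Complex.exp_add]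
  congr 1
  simp only [add_mul, Finset.sum_add_distrib]
  push_cast
  ring

theorem norm_expNeg (ξ x : ι → ℝ) : ‖expNeg ξ x‖ = 1 :=
  Complex.norm_exp_ofReal_mul_I _

theorem continuous_expNeg (ξ : ι → ℝ) : Continuous (expNeg ξ) := by
  unfold expNeg
  fun_prop

theorem expNeg_eq_one_iff (ξ x : ι → ℝ) : expNeg ξ x = 1 ↔ ∃ N : ℤ, ∑ i, x i * ξ i = N := by
  rw [expNeg, Complex.exp_eq_one_iff]
  have h2 : (2 * Real.pi : ℝ) ≠ 0 := by positivity
  have key : ∀ N : ℤ, (((-(2 * Real.pi * ∑ i, x i * ξ i) : ℝ) : ℂ) * Complex.I =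
      N * (2 * Real.pi * Complex.I)) ↔ ∑ i, x i * ξ i = ((-N : ℤ) : ℝ) := by
    intro N
    rw [← mul_assoc, mul_left_inj' Complex.I_ne_zero]
    norm_cast
    push_cast
    constructor
    · intro h
      apply mul_left_cancel₀ h2
      linarith
    · intro h
      rw [h]
      ring
  simp only [key]
  exact ⟨fun ⟨N, h⟩ => ⟨-N, h⟩, fun ⟨N, h⟩ => ⟨-N, by simpa using h⟩⟩

theorem expNeg_intCast (k r : ι → ℤ) : expNeg (fun i => (k i : ℝ)) (fun i => (r i : ℝ)) = 1 :=
  (expNeg_eq_one_iff _ _).2 ⟨∑ i, r i * k i, by push_cast; rfl⟩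

theorem expNeg_add_intCast (k r : ι → ℤ) (x : ι → ℝ) :
    expNeg (fun i => (k i : ℝ)) (fun i => x i + r i) = expNeg (fun i => (k i : ℝ)) x := by
  rw [expNeg_add, expNeg_intCast, mul_one]

end Characters

section Periodization

variable {m n : ℕ}

theorem PhiEps_add_intCast (φ : (Fin m → ℝ) → ℝ) (ε : ℝ) (y : Fin m → ℝ) (r : Fin m → ℤ) :
    PhiEps φ ε (fun i => y i + r i) = PhiEps φ ε y := by
  unfold PhiEps
  rw [← (Equiv.addRight r).tsum_eq]
  refine tsum_congr fun s => ?_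
  simp

theorem measurable_PhiEps {φ : (Fin m → ℝ) → ℝ} (hφ : Measurable φ) (ε : ℝ) :
    Measurable (PhiEps φ ε) := by
  unfold PhiEps
  refine Measurable.tsum fun r => (hφ.comp ?_).const_mul _
  fun_prop

theorem measurable_PhiQ {φ : (Fin m → ℝ) → ℝ} (hφ : Measurable φ) (ε : ℝ) (q : Fin n → ℤ)
    (θ : Fin m → ℝ) : Measurable (PhiQ φ ε q θ) := by
  refine (measurable_PhiEps hφ ε).comp ?_
  fun_prop

theorem PhiQ_add (φ : (Fin m → ℝ) → ℝ) (ε : ℝ) (q : Fin n → ℤ) (θ : Fin m → ℝ)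
    (x t : Fin m × Fin n → ℝ) {r : Fin m → ℤ} (ht : ∀ i, ∑ j, t (i, j) * (q j : ℝ) = r i) :
    PhiQ φ ε q θ (fun p => x p + t p) = PhiQ φ ε q θ x := by
  unfold PhiQ
  rw [← PhiEps_add_intCast φ ε (fun i => (∑ j, x (i, j) * (q j : ℝ)) - θ i) r]
  congr 1
  ext i
  rw [← ht i]
  simp only [add_mul, Finset.sum_add_distrib]
  ring

theorem fcoef_eq {f : (Fin m × Fin n → ℝ) → ℝ} {l : Fin m × Fin n → ℤ} :
    fcoef f l = ∫ x in {x : Fin m × Fin n → ℝ | ∀ p, x p ∈ Set.Icc (0 : ℝ) 1},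
      (f x : ℂ) * expNeg (fun p => (l p : ℝ)) x := rfl

/-- If every `t` with `tq ∈ ℤ^m` satisfies `ℓ·t ∈ ℤ`, then `q` divides `ℓ`. -/
theorem mem_Dset_of_forall_dual {l : Fin m × Fin n → ℤ} {q : Fin n → ℤ} {j : Fin n}
    (hq : q j ≠ 0)
    (h : ∀ (t : Fin m × Fin n → ℝ) (r : Fin m → ℤ), (∀ i, ∑ j, t (i, j) * (q j : ℝ) = r i) →
      ∃ N : ℤ, ∑ p, t p * (l p : ℝ) = N) : q ∈ Dset m n l := by
  have hq' : (q j : ℝ) ≠ 0 := by exact_mod_cast hq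
  have hk : ∀ i, ∃ k : ℤ, l (i, j) = k * q j := by
    intro i
    obtain ⟨N, hN⟩ := h (Pi.single (i, j) (q j : ℝ)⁻¹) (Pi.single i 1) (by
      intro i'
      by_cases hi : i' = i
      · subst hi
        rw [Finset.sum_eq_single j] <;> simp +contextual [hq']
      · simp [hi])
    refine ⟨N, ?_⟩
    rw [Finset.sum_eq_single (i, j) (by simp +contextual) (by simp)] at hN
    rw [Pi.single_eq_same] at hN
    field_simp at hN
    exact_mod_cast hN.trans (mul_comm _ _)
  choose k hk using hk
  refine ⟨k, fun i j' => ?_⟩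
  by_contra hne
  set d : ℝ := l (i, j') - k i * q j' with hd
  have hd0 : d ≠ 0 := by
    rw [hd, sub_ne_zero]
    exact_mod_cast hne
  obtain ⟨N, hN⟩ := h
    (fun p => (2 * d)⁻¹ * (if p.1 = i ∧ p.2 = j' then 1 else 0)
      - (2 * d)⁻¹ * (q j' / q j) * (if p.1 = i ∧ p.2 = j then 1 else 0)) 0 (by
      intro i'
      by_cases hi : i' = i
      · simp [hi, sub_mul, Finset.sum_sub_distrib]
        field_simp
        ring
      · simp [hi])
  have hval : ∑ p : Fin m × Fin n, ((2 * d)⁻¹ * (if p.1 = i ∧ p.2 = j' then 1 else 0)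
      - (2 * d)⁻¹ * (q j' / q j) * (if p.1 = i ∧ p.2 = j then 1 else 0)) * (l p : ℝ)
      = (2 * d)⁻¹ * d := by
    have hl : (l (i, j) : ℝ) = k i * q j := by exact_mod_cast hk i
    simp only [← Prod.mk_inj, Prod.mk.eta, sub_mul, Finset.sum_sub_distrib, mul_assoc, ite_mul,
      one_mul, zero_mul, mul_ite, mul_zero, Finset.sum_ite_eq', Finset.mem_univ, if_true, hl]
    rw [hd]
    field_simp
  rw [hval] at hN
  have h2 : (1 : ℝ) = 2 * N := by
    rw [← hN]
    field_simp
  have h3 : (1 : ℤ) = 2 * N := by exact_mod_cast h2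
  omega

theorem fcoef_PhiQ_of_notMem_Dset {φ : (Fin m → ℝ) → ℝ} (hφ : Measurable φ) (ε : ℝ)
    (θ : Fin m → ℝ) {l : Fin m × Fin n → ℤ} {q : Fin n → ℤ} {j : Fin n} (hq : q j ≠ 0)
    (hl : q ∉ Dset m n l) : fcoef (PhiQ φ ε q θ) l = 0 := by
  by_contra hne
  refine hl (mem_Dset_of_forall_dual hq fun t r ht => ?_)
  rw [← expNeg_eq_one_iff (fun p => (l p : ℝ)) t]
  have h := setIntegral_unitCube_add
    (w := fun x => (PhiQ φ ε q θ x : ℂ) * expNeg (fun p => (l p : ℝ)) x)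
    ((Complex.measurable_ofReal.comp (measurable_PhiQ hφ ε q θ)).mul
      (continuous_expNeg _).measurable)
    (fun x s => by
      rw [expNeg_add_intCast, PhiQ_add φ ε q θ x _ (r := fun i => ∑ j, s (i, j) * q j)]
      intro i
      push_cast
      rfl) t
  simp only [expNeg_add, PhiQ_add φ ε q θ _ t ht, ← mul_assoc] at h
  rw [integral_mul_const, ← fcoef_eq] at h
  exact mul_left_cancel₀ hne (h.trans (mul_one _).symm)

theorem fcoef_PhiQ_of_mem_Dset {φ : (Fin m → ℝ) → ℝ} (hφ : Measurable φ) (hint : Integrable φ)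
    {ε : ℝ} (hε : 0 < ε) (θ : Fin m → ℝ) {l : Fin m × Fin n → ℤ} {q : Fin n → ℤ} {j : Fin n}
    (hq : q j ≠ 0) {k : Fin m → ℤ} (hk : ∀ i j, l (i, j) = k i * q j) :
    fcoef (PhiQ φ ε q θ) l = expNeg (fun i => (k i : ℝ)) θ * ftRm φ (fun i => ε * k i) := by
  set e := expNeg (fun i => (k i : ℝ)) with he
  set w : (Fin m → ℝ) → ℂ := fun y => (PhiEps φ ε (fun i => y i - θ i) : ℂ) * e y with hw
  set g₀ : (Fin m → ℝ) → ℂ := fun u => (φ u : ℂ) * e (fun i => ε * u i + θ i) with hg₀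
  have hg₀int : Integrable g₀ := by
    refine hint.ofReal.mul_bdd (c := 1) ?_ (Filter.Eventually.of_forall fun u => (norm_expNeg _ _).le)
    exact ((continuous_expNeg _).comp (by fun_prop)).aestronglyMeasurable
  set g : (Fin m → ℝ) → ℂ := fun v => ((ε ^ m)⁻¹ : ℝ) * g₀ (ε⁻¹ • (v - θ)) with hg
  have hgint : Integrable g :=
    ((hg₀int.comp_smul (inv_ne_zero hε.ne')).comp_sub_right θ).const_mul _
  have hwg : ∀ y, w y = ∑' r : Fin m → ℤ, g (fun i => y i - r i) := by
    intro y
    simp only [hw, PhiEps, Complex.ofReal_tsum, ← tsum_mul_right]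
    refine tsum_congr fun r => ?_
    have h1 : e y = e (fun i => y i - r i) := by
      simpa using expNeg_add_intCast k r (fun i => y i - r i)
    have h2 : (fun i => ε * (ε⁻¹ • ((fun i => y i - (r i : ℝ)) - θ)) i + θ i)
        = fun i => y i - (r i : ℝ) := by
      ext i
      simp only [Pi.smul_apply, Pi.sub_apply, smul_eq_mul]
      field_simp
      ring
    have h3 : (ε⁻¹ • ((fun i => y i - (r i : ℝ)) - θ)) = fun i => (y i - θ i - r i) / ε := by
      ext i
      simp only [Pi.smul_apply, Pi.sub_apply, smul_eq_mul]
      field_simp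
      ring
    simp only [hg, hg₀]
    rw [h2, h3, h1]
    push_cast
    ring
  have hwmeas : Measurable w :=
    (Complex.measurable_ofReal.comp ((measurable_PhiEps hφ ε).comp (by fun_prop))).mul
      (continuous_expNeg _).measurable
  have hwper : ∀ (x : Fin m → ℝ) (r : Fin m → ℤ), w (fun i => x i + r i) = w x := by
    intro x r
    simp only [hw, he, expNeg_add_intCast]
    rw [← PhiEps_add_intCast φ ε (fun i => x i - θ i) r]
    simp only [add_sub_right_comm]
  have hexp : ∀ x : Fin m × Fin n → ℝ, expNeg (fun p => (l p : ℝ)) x =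
      e (fun i => ∑ j, x (i, j) * (q j : ℝ)) := by
    intro x
    simp only [he, expNeg, Fintype.sum_prod_type, hk, Finset.sum_mul]
    push_cast
    simp only [mul_assoc, mul_comm (q _ : ℂ)]
  calc fcoef (PhiQ φ ε q θ) l
      = ∫ x in {x : Fin m × Fin n → ℝ | ∀ p, x p ∈ Set.Icc (0 : ℝ) 1},
          w (fun i => ∑ j, x (i, j) * (q j : ℝ)) := by
        rw [fcoef_eq]
        simp only [hexp, hw, PhiQ]
    _ = ∫ x in {x : Fin m → ℝ | ∀ i, x i ∈ Set.Icc (0 : ℝ) 1}, w x :=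
        setIntegral_unitCube_mulVec hwmeas hwper hq
    _ = ∫ v, g v := by
        simp only [hwg]
        exact setIntegral_unitCube_tsum hgint
    _ = ∫ u, g₀ u := by
        rw [hg, integral_const_mul, integral_sub_right_eq_self (fun v => g₀ (ε⁻¹ • v)) θ,
          Measure.integral_comp_inv_smul_of_nonneg _ _ hε.le, Module.finrank_fin_fun,
          Complex.real_smul, ← mul_assoc, ← Complex.ofReal_mul,
          inv_mul_cancel₀ (pow_pos hε m).ne', Complex.ofReal_one, one_mul]
    _ = e θ * ftRm φ (fun i => ε * k i) := by
        rw [ftRm, ← integral_const_mul]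
        refine integral_congr_ae (Filter.Eventually.of_forall fun u => ?_)
        have h4 : expNeg (fun i => (k i : ℝ)) (fun i => ε * u i) =
            Complex.exp (((-(2 * Real.pi * ∑ i, u i * (ε * k i)) : ℝ) : ℂ) * Complex.I) := by
          rw [expNeg]
          simp only [mul_comm ε, mul_assoc]
        simp only [hg₀, he, expNeg_add, h4]
        ring

end Periodization

/-- Fourier coefficients of `Φ^ε_{q,θ}`: for `j` with `q_j ≠ 0`, the `ℓ`-th coefficient equals
`e^{-2πi (ℓ_j·θ)/q_j} φ̂(ε ℓ_j/q_j)` if `q ∈ D(ℓ)` and `0` otherwise, where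
`ℓ_j = (ℓ_{1j},…,ℓ_{mj})`. -/
theorem PhiQ_fourierCoeff (m n : ℕ) (φ : (Fin m → ℝ) → ℝ)
    (hφ0 : ∀ x, 0 ≤ φ x) (hmeas : Measurable φ)
    (hsupp : Function.support φ ⊆ {x | ∀ i, x i ∈ Set.Ioo (-1 : ℝ) 1})
    (hint : ∫ x : Fin m → ℝ, φ x = 1)
    (K : ℕ) (hK : m < K) (C : ℝ)
    (hdecay : ∀ ξ : Fin m → ℝ, ‖ftRm φ ξ‖ ≤ C * (1 + ‖ξ‖) ^ (-(K : ℝ)))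
    (ε : ℝ) (hε : 0 < ε) (θ : Fin m → ℝ) (l : Fin m × Fin n → ℤ) (q : Fin n → ℤ)
    (j : Fin n) (hqj : q j ≠ 0) :
    (q ∈ Dset m n l → fcoef (PhiQ φ ε q θ) l =
      Complex.exp
          (((-(2 * Real.pi * ((∑ i : Fin m, (l (i, j) : ℝ) * θ i) / (q j : ℝ))) : ℝ) : ℂ) *
            Complex.I) *
        ftRm φ (fun i => ε * (l (i, j) : ℝ) / (q j : ℝ))) ∧
    (q ∉ Dset m n l → fcoef (PhiQ φ ε q θ) l = 0) := by
  have hφ : Integrable φ := by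
    by_contra h
    rw [integral_undef h] at hint
    exact zero_ne_one hint
  refine ⟨?_, fcoef_PhiQ_of_notMem_Dset hmeas ε θ hqj⟩
  rintro ⟨k, hk⟩
  have hqj' : (q j : ℝ) ≠ 0 := by exact_mod_cast hqj
  rw [fcoef_PhiQ_of_mem_Dset hmeas hφ hε θ hqj hk, expNeg]
  congr 1
  · congr 4
    rw [Finset.sum_div]
    congr 1
    refine Finset.sum_congr rfl fun i _ => ?_
    rw [hk]
    push_cast
    field_simp
  · congr 1
    ext i
    rw [hk]
    push_cast
    field_simp
end
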